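/- There exists an absolute constant c > 0 with the following property. Let A, B ⊆ ℝ be finite sets with A nonempty and let G ⊆ A × B. Then max{|A +_G B|, |A ·_G B|} ≥ c · |G|^(3/4) / |A|^(3/8). -/

import Mathlib

open Finset in
/-- A finite set has at most as many elements as a map has values on it, plus the number of
collisions of that map. -/
theorem card_le_card_image_add_card_collisions {α β : Type*} [DecidableEq α] [DecidableEq β]
    (T : Finset α) (f : α → β) :
    #T ≤ #(T.image f) + #{x ∈ T.offDiag | f x.1 = f x.2} := by
  induction T using Finset.induction_on with
  | empty => simp
  | insert x T hx ih =>
    rw [card_insert_of_notMem hx, image_insert]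
    by_cases h : f x ∈ T.image f
    · obtain ⟨y, hy, hyx⟩ := mem_image.1 h
      rw [insert_eq_of_mem h]
      have hlt : #{z ∈ T.offDiag | f z.1 = f z.2} <
          #{z ∈ (insert x T).offDiag | f z.1 = f z.2} := by
        refine card_lt_card ⟨filter_subset_filter _ (offDiag_mono (subset_insert x T)), fun hs => ?_⟩
        have hmem : (x, y) ∈ (insert x T).offDiag.filter (fun z => f z.1 = f z.2) := by
          exact mem_filter.2 ⟨mem_offDiag.2 ⟨mem_insert_self x T, mem_insert_of_mem hy,
            ne_of_mem_of_not_mem hy hx |>.symm⟩, hyx.symm⟩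
        exact hx (mem_offDiag.1 (mem_filter.1 (hs hmem)).1).1
      omega
    · rw [card_insert_of_notMem h]
      have hle : #{z ∈ T.offDiag | f z.1 = f z.2} ≤
          #{z ∈ (insert x T).offDiag | f z.1 = f z.2} :=
        card_le_card (filter_subset_filter _ (offDiag_mono (subset_insert x T)))
      omega

/-- The index of the block containing `x` when `P` is cut, in increasing order, into consecutive
blocks of `q` elements. -/
noncomputable def blockIndex (P : Finset ℝ) (q : ℕ) (x : ℝ) : ℕ :=
  (P.filter (· < x)).card / q

theorem blockIndex_mono (P : Finset ℝ) (q : ℕ) : Monotone (blockIndex P q) := fun _ _ h =>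
  Nat.div_le_div_right (Finset.card_le_card
    (Finset.monotone_filter_right _ fun _ _ hz => lt_of_lt_of_le hz h))

theorem blockIndex_le (P : Finset ℝ) (q : ℕ) (x : ℝ) : blockIndex P q x ≤ P.card / q :=
  Nat.div_le_div_right (Finset.card_filter_le _ _)

open Finset in
theorem card_blockIndex_fiber_le (P : Finset ℝ) {q : ℕ} (hq : 0 < q) (k : ℕ) :
    #{y ∈ P | blockIndex P q y = k} ≤ q := by
  have hinj : Set.InjOn (fun y : ℝ => #{z ∈ P | z < y}) (P : Set ℝ) := by
    refine StrictMonoOn.injOn fun x hx y _ hxy => card_lt_card ⟨?_, fun hs => ?_⟩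
    · exact monotone_filter_right _ fun _ _ hz => lt_trans hz hxy
    · exact lt_irrefl x (mem_filter.1 (hs (mem_filter.2 ⟨hx, hxy⟩))).2
  calc #{y ∈ P | blockIndex P q y = k} ≤ #(Ico (k * q) (k * q + q)) := by
        refine card_le_card_of_injOn (fun y : ℝ => #{z ∈ P | z < y}) (fun y hy => ?_)
          (hinj.mono fun y hy => (mem_filter.1 hy).1)
        have hk := (mem_filter.1 hy).2
        unfold blockIndex at hk
        rw [Nat.div_eq_iff hq] at hk
        simp only [coe_Ico, Set.mem_Ico]
        omega
    _ = q := by simp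

open Finset in
theorem card_pairs_same_block_le (P : Finset ℝ) {q : ℕ} (hq : 0 < q) :
    #{x ∈ P ×ˢ P | blockIndex P q x.1 = blockIndex P q x.2} ≤ #P * q := by
  rw [card_filter, sum_product]
  calc ∑ x ∈ P, ∑ y ∈ P, (if blockIndex P q x = blockIndex P q y then 1 else 0)
      ≤ ∑ _x ∈ P, q := sum_le_sum fun x _ => by
        rw [← card_filter]
        simpa only [eq_comm] using card_blockIndex_fiber_le P hq (blockIndex P q x)
    _ = #P * q := by simp

theorem mul_sub_sq_le_of_le {s t u : ℝ} (h : t ≤ u) (hu : 2 * u < s) :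
    t * s - t ^ 2 ≤ u * s - u ^ 2 := by nlinarith

theorem mul_sub_sq_ge_of_le {s t u : ℝ} (h : t ≤ u) (ht : ¬ 2 * t < s) :
    u * s - u ^ 2 ≤ t * s - t ^ 2 := by nlinarith

/-- A code for the cell of a grid which contains the point `(t * s - t ^ 2, t * s' - t ^ 2)`
of a parabola, together with the part of the parabola on which this point lies. -/
noncomputable def cellCode (i : ℝ → ℕ) (K : ℕ) (s s' t : ℝ) : Bool × Bool × ℕ :=
  (decide (2 * t < s), decide (2 * t < s'),
    if (2 * t < s ↔ 2 * t < s') then i (t * s - t ^ 2) + i (t * s' - t ^ 2)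
    else i (t * s - t ^ 2) + (K - i (t * s' - t ^ 2)))

theorem cell_eq_of_cellCode_eq {i : ℝ → ℕ} (hi : Monotone i) {K : ℕ} (hK : ∀ x, i x ≤ K)
    {s s' t u : ℝ} (h : cellCode i K s s' t = cellCode i K s s' u) :
    i (t * s - t ^ 2) = i (u * s - u ^ 2) ∧ i (t * s' - t ^ 2) = i (u * s' - u ^ 2) := by
  wlog htu : t ≤ u generalizing t u
  · have := this h.symm (le_of_not_ge htu)
    exact ⟨this.1.symm, this.2.symm⟩
  simp only [cellCode, Prod.mk.injEq, decide_eq_decide] at h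
  obtain ⟨h1, h2, h3⟩ := h
  have k1 := hK (t * s' - t ^ 2)
  have k2 := hK (u * s' - u ^ 2)
  by_cases a : 2 * u < s <;> by_cases b : 2 * u < s' <;>
    simp only [h1, h2, a, b, iff_self, if_true, iff_false, not_true_eq_false, if_false,
      false_iff] at h3
  · have := hi (mul_sub_sq_le_of_le htu a)
    have := hi (mul_sub_sq_le_of_le htu b)
    omega
  · have := hi (mul_sub_sq_le_of_le htu a)
    have := hi (mul_sub_sq_ge_of_le htu (h2.not.2 b))
    omega
  · have := hi (mul_sub_sq_ge_of_le htu (h1.not.2 a))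
    have := hi (mul_sub_sq_le_of_le htu b)
    omega
  · have := hi (mul_sub_sq_ge_of_le htu (h1.not.2 a))
    have := hi (mul_sub_sq_ge_of_le htu (h2.not.2 b))
    omega

open Finset in
theorem card_image_cellCode_le {i : ℝ → ℕ} {K : ℕ} (hK : ∀ x, i x ≤ K) (s s' : ℝ)
    (T : Finset ℝ) : #(T.image (cellCode i K s s')) ≤ 4 * (2 * K + 1) := by
  calc #(T.image (cellCode i K s s'))
      ≤ #((univ : Finset Bool) ×ˢ (univ : Finset Bool) ×ˢ range (2 * K + 1)) := by
        refine card_le_card fun z hz => ?_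
        obtain ⟨t, -, rfl⟩ := mem_image.1 hz
        have k1 := hK (t * s - t ^ 2)
        have k2 := hK (t * s' - t ^ 2)
        simp only [cellCode, mem_product, mem_univ, mem_range, true_and]
        split_ifs <;> omega
    _ = 4 * (2 * K + 1) := by simp [card_product]; ring

/-- Two points determine the parabola `t ↦ (t * s - t ^ 2, t * s' - t ^ 2)` through them up to the
sign of `s - s'`. -/
theorem parabola_unique {s s' a b S S' α β : ℝ} (hα : α ≠ 0) (hβ : β ≠ 0)
    (hab : a ≠ b) (hs : s ≠ s') (hS : S ≠ S') (hsign : s' < s ↔ S' < S)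
    (h1 : a * s - a ^ 2 = α * S - α ^ 2) (h2 : b * s - b ^ 2 = β * S - β ^ 2)
    (h3 : a * s' - a ^ 2 = α * S' - α ^ 2) (h4 : b * s' - b ^ 2 = β * S' - β ^ 2) :
    s = S ∧ s' = S' ∧ a = α ∧ b = β := by
  have hd : s - s' ≠ 0 := sub_ne_zero.2 hs
  obtain ⟨l, hl⟩ : ∃ l, S - S' = l * (s - s') := ⟨(S - S') / (s - s'), by field_simp⟩
  have hl0 : 0 < l := by
    rcases lt_or_gt_of_ne hs with h | h
    · have : S < S' := lt_of_le_of_ne (not_lt.1 (hsign.not.1 (not_lt.2 h.le))) hS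
      by_contra! hc
      nlinarith
    · have := hsign.1 h
      by_contra! hc
      nlinarith
  have ea : a = l * α := mul_left_cancel₀ hd (by linear_combination h1 - h3 + α * hl)
  have eb : b = l * β := mul_left_cancel₀ hd (by linear_combination h2 - h4 + β * hl)
  have e1 : l * s - l ^ 2 * α = S - α :=
    mul_left_cancel₀ hα (by rw [ea] at h1; linear_combination h1)
  have e2 : l * s - l ^ 2 * β = S - β :=
    mul_left_cancel₀ hβ (by rw [eb] at h2; linear_combination h2)
  have hαβ : α - β ≠ 0 := fun h => hab (by rw [ea, eb, sub_eq_zero.1 h])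
  have hl2 : l ^ 2 = 1 := mul_left_cancel₀ hαβ (by linear_combination e2 - e1)
  have hl1 : l = 1 := by nlinarith
  subst hl1
  refine ⟨by linarith, by linarith, by linarith, by linarith⟩

open Finset in
theorem sum_offDiag_card_common_le (A S P : Finset ℝ) (hA : (0 : ℝ) ∉ A) {q : ℕ} (hq : 0 < q) :
    ∑ z ∈ S.offDiag, #{a ∈ A | a * z.1 - a ^ 2 ∈ P ∧ a * z.2 - a ^ 2 ∈ P} ≤
      #S ^ 2 * (4 * (2 * (#P / q) + 1)) + 2 * (#P * q) ^ 2 := by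
  set T : ℝ × ℝ → Finset ℝ :=
    fun z => {a ∈ A | a * z.1 - a ^ 2 ∈ P ∧ a * z.2 - a ^ 2 ∈ P} with hT
  set F : ℝ × ℝ → ℝ → Bool × Bool × ℕ :=
    fun z => cellCode (blockIndex P q) (#P / q) z.1 z.2 with hF
  set D : ℝ × ℝ → Finset (ℝ × ℝ) := fun z => {x ∈ (T z).offDiag | F z x.1 = F z x.2} with hD
  set W : Finset (ℝ × ℝ) := {x ∈ P ×ˢ P | blockIndex P q x.1 = blockIndex P q x.2} with hW
  have hcol : ∑ z ∈ S.offDiag, #(D z) ≤ 2 * (#P * q) ^ 2 := by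
    rw [← card_sigma]
    calc #(S.offDiag.sigma D) ≤ #((univ : Finset Bool) ×ˢ W ×ˢ W) := by
          refine card_le_card_of_injOn
            (fun x => (decide (x.1.2 < x.1.1),
              (x.2.1 * x.1.1 - x.2.1 ^ 2, x.2.2 * x.1.1 - x.2.2 ^ 2),
              (x.2.1 * x.1.2 - x.2.1 ^ 2, x.2.2 * x.1.2 - x.2.2 ^ 2))) ?_ ?_
          · rintro ⟨⟨s, s'⟩, a, b⟩ hx
            simp only [coe_sigma, Set.mem_sigma_iff, mem_coe, hD, hT, mem_filter,
              mem_offDiag] at hx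
            obtain ⟨-, ⟨⟨-, ha1, ha2⟩, ⟨-, hb1, hb2⟩, -⟩, hc⟩ := hx
            have := cell_eq_of_cellCode_eq (blockIndex_mono P q) (blockIndex_le P q) hc
            simp only [mem_coe, mem_product, mem_univ, true_and, hW, mem_filter]
            exact ⟨⟨⟨ha1, hb1⟩, this.1⟩, ⟨ha2, hb2⟩, this.2⟩
          · rintro ⟨⟨s, s'⟩, a, b⟩ hx ⟨⟨S₁, S₂⟩, α, β⟩ hy hxy
            simp only [coe_sigma, Set.mem_sigma_iff, mem_coe, hD, hT, mem_filter,
              mem_offDiag] at hx hy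
            simp only [Prod.mk.injEq, decide_eq_decide] at hxy
            obtain ⟨hsign, ⟨h1, h2⟩, h3, h4⟩ := hxy
            obtain ⟨rfl, rfl, rfl, rfl⟩ := parabola_unique
              (fun h => hA (h ▸ hy.2.1.1.1)) (fun h => hA (h ▸ hy.2.1.2.1.1))
              hx.2.1.2.2 hx.1.2.2 hy.1.2.2 hsign h1 h2 h3 h4
            rfl
      _ = 2 * #W ^ 2 := by simp [card_product]; ring
      _ ≤ 2 * (#P * q) ^ 2 := by
          gcongr
          exact card_pairs_same_block_le P hq
  calc ∑ z ∈ S.offDiag, #(T z)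
      ≤ ∑ z ∈ S.offDiag, (4 * (2 * (#P / q) + 1) + #(D z)) := sum_le_sum fun z _ =>
        (card_le_card_image_add_card_collisions (T z) (F z)).trans
          (Nat.add_le_add_right (card_image_cellCode_le (blockIndex_le P q) z.1 z.2 (T z)) _)
    _ = #S.offDiag * (4 * (2 * (#P / q) + 1)) + ∑ z ∈ S.offDiag, #(D z) := by
        rw [sum_add_distrib, sum_const, smul_eq_mul]
    _ ≤ _ := by
        refine Nat.add_le_add (Nat.mul_le_mul_right _ ?_) hcol
        rw [offDiag_card, sq]
        exact Nat.sub_le _ _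

open Finset in
theorem card_mul_sub_sq_mem_le (A P : Finset ℝ) (s : ℝ) :
    #{a ∈ A | a * s - a ^ 2 ∈ P} ≤ 2 * #P := by
  calc #{a ∈ A | a * s - a ^ 2 ∈ P} ≤ #((univ : Finset Bool) ×ˢ P) := by
        refine card_le_card_of_injOn (fun a => (decide (2 * a < s), a * s - a ^ 2)) ?_ ?_
        · intro a ha
          exact mem_coe.2 (mem_product.2 ⟨mem_univ _, (mem_filter.1 ha).2⟩)
        · intro a _ b _ hab
          simp only [Prod.mk.injEq, decide_eq_decide] at hab
          obtain ⟨h1, h2⟩ := hab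
          have h3 : (a - b) * (s - a - b) = 0 := by linear_combination h2
          rcases mul_eq_zero.1 h3 with h | h
          · linarith
          · by_cases hb : 2 * b < s
            · linarith [h1.2 hb]
            · linarith [not_lt.1 hb, not_lt.1 (h1.not.2 hb)]
    _ = 2 * #P := by simp [card_product]

open Finset in
theorem sum_sq_card_mul_sub_sq_mem_le (A S P : Finset ℝ) (hA : (0 : ℝ) ∉ A) {q : ℕ}
    (hq : 0 < q) :
    ∑ a ∈ A, #{s ∈ S | a * s - a ^ 2 ∈ P} ^ 2 ≤
      2 * #S * #P + #S ^ 2 * (4 * (2 * (#P / q) + 1)) + 2 * (#P * q) ^ 2 := by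
  have hswap : ∑ a ∈ A, #{s ∈ S | a * s - a ^ 2 ∈ P} ^ 2 =
      ∑ z ∈ S ×ˢ S, #{a ∈ A | a * z.1 - a ^ 2 ∈ P ∧ a * z.2 - a ^ 2 ∈ P} := by
    simp only [card_filter _ A]
    rw [sum_comm]
    refine sum_congr rfl fun a _ => ?_
    rw [← card_filter, sq, ← card_product, ← filter_product]
  have hdiag : ∑ z ∈ S.diag, #{a ∈ A | a * z.1 - a ^ 2 ∈ P ∧ a * z.2 - a ^ 2 ∈ P} ≤
      2 * #S * #P := by
    calc _ ≤ ∑ _z ∈ S.diag, 2 * #P := sum_le_sum fun z _ =>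
          (card_le_card (monotone_filter_right _ fun _ _ h => h.1)).trans
            (card_mul_sub_sq_mem_le A P z.1)
      _ = 2 * #S * #P := by rw [sum_const, diag_card, smul_eq_mul]; ring
  rw [hswap, ← diag_union_offDiag, sum_union (disjoint_diag_offDiag S), add_assoc]
  exact Nat.add_le_add hdiag (sum_offDiag_card_common_le A S P hA hq)

open Finset in
theorem sq_card_nonzero_edges_le (A B : Finset ℝ) (G : Finset (ℝ × ℝ)) (hG : G ⊆ A ×ˢ B)
    {M q : ℕ} (hS : #(G.image fun p => p.1 + p.2) ≤ M) (hP : #(G.image fun p => p.1 * p.2) ≤ M)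
    (hq : 0 < q) :
    #{p ∈ G | p.1 ≠ 0} ^ 2 ≤
      #A * (2 * M * M + M ^ 2 * (4 * (2 * (M / q) + 1)) + 2 * (M * q) ^ 2) := by
  set S := G.image fun p => p.1 + p.2 with hSdef
  set P := G.image fun p => p.1 * p.2 with hPdef
  have hfib : #{p ∈ G | p.1 ≠ 0} ≤ ∑ a ∈ A.erase 0, #{s ∈ S | a * s - a ^ 2 ∈ P} := by
    rw [card_eq_sum_card_fiberwise (f := Prod.fst) (t := A.erase 0)]
    · refine sum_le_sum fun a _ => card_le_card_of_injOn (fun p => p.1 + p.2) ?_ ?_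
      · intro p hp
        simp only [coe_filter, mem_filter, Set.mem_ofPred_eq] at hp ⊢
        obtain ⟨⟨hp, -⟩, rfl⟩ := hp
        refine ⟨mem_image_of_mem _ hp, mem_image.2 ⟨p, hp, by ring⟩⟩
      · intro p hp r hr hpr
        simp only [coe_filter, mem_filter, Set.mem_ofPred_eq] at hp hr hpr
        have h1 : p.1 = r.1 := hp.2.trans hr.2.symm
        exact Prod.ext h1 (by linarith)
    · intro p hp
      simp only [coe_filter, Set.mem_ofPred_eq] at hp
      exact mem_coe.2 (mem_erase.2 ⟨hp.2, (mem_product.1 (hG hp.1)).1⟩)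
  calc #{p ∈ G | p.1 ≠ 0} ^ 2
      ≤ (∑ a ∈ A.erase 0, #{s ∈ S | a * s - a ^ 2 ∈ P}) ^ 2 := Nat.pow_le_pow_left hfib 2
    _ ≤ #(A.erase 0) * ∑ a ∈ A.erase 0, #{s ∈ S | a * s - a ^ 2 ∈ P} ^ 2 :=
        sq_sum_le_card_mul_sum_sq
    _ ≤ #A * (2 * #S * #P + #S ^ 2 * (4 * (2 * (#P / q) + 1)) + 2 * (#P * q) ^ 2) :=
        Nat.mul_le_mul (card_le_card (erase_subset _ _))
          (sum_sq_card_mul_sub_sq_mem_le _ S P (notMem_erase 0 A) hq)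
    _ ≤ _ := by gcongr

open Finset in
theorem card_zero_edges_le (G : Finset (ℝ × ℝ)) :
    #{p ∈ G | ¬ p.1 ≠ 0} ≤ #(G.image fun p => p.1 + p.2) := by
  refine card_le_card_of_injOn (fun p => p.1 + p.2)
    (fun p hp => mem_coe.2 (mem_image_of_mem _ (mem_filter.1 hp).1)) fun p hp r hr hpr => ?_
  simp only [coe_filter, not_not, Set.mem_ofPred_eq] at hp hr hpr
  exact Prod.ext (hp.2.trans hr.2.symm) (by linarith [hp.2, hr.2])

open Finset in
theorem sq_card_edges_le (A B : Finset ℝ) (G : Finset (ℝ × ℝ)) (hA : A.Nonempty)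
    (hG : G ⊆ A ×ˢ B) {M : ℕ} (hM : 0 < M) (hS : #(G.image fun p => p.1 + p.2) ≤ M)
    (hP : #(G.image fun p => p.1 * p.2) ≤ M) :
    (#G : ℝ) ^ 2 ≤ 46 * #A * (M : ℝ) ^ ((8 : ℝ) / 3) := by
  have hM1 : (1 : ℝ) ≤ M := by exact_mod_cast hM
  set x : ℝ := (M : ℝ) ^ ((1 : ℝ) / 3) with hx
  have hx1 : 1 ≤ x := Real.one_le_rpow hM1 (by norm_num)
  have hx3 : (M : ℝ) = x ^ 3 := by
    rw [hx, ← Real.rpow_natCast, ← Real.rpow_mul (by positivity)]; norm_num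
  have hx8 : (M : ℝ) ^ ((8 : ℝ) / 3) = x ^ 8 := by
    rw [hx, ← Real.rpow_natCast, ← Real.rpow_mul (by positivity)]; norm_num
  set q := ⌈x⌉₊ with hqdef
  have hqx : x ≤ q := Nat.le_ceil x
  have hq2 : (q : ℝ) ≤ 2 * x := by linarith [Nat.ceil_lt_add_one (by linarith : 0 ≤ x)]
  have hq : 0 < q := Nat.ceil_pos.2 (by linarith)
  have hdiv : ((M / q : ℕ) : ℝ) ≤ x ^ 2 := by
    refine Nat.cast_div_le.trans ((div_le_iff₀ (by exact_mod_cast hq)).2 ?_)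
    rw [hx3]
    nlinarith [sq_nonneg x]
  have hn : (1 : ℝ) ≤ #A := by exact_mod_cast hA.card_pos
  have hnz : ((#{p ∈ G | p.1 ≠ 0} : ℕ) : ℝ) ^ 2 ≤
      #A * (2 * M * M + M ^ 2 * (4 * (2 * (M / q : ℕ) + 1)) + 2 * (M * q) ^ 2) := by
    exact_mod_cast sq_card_nonzero_edges_le A B G hG hS hP hq
  have hz : ((#{p ∈ G | ¬ p.1 ≠ 0} : ℕ) : ℝ) ≤ M := by
    exact_mod_cast (card_zero_edges_le G).trans hS
  have hsum : ((#{p ∈ G | p.1 ≠ 0} : ℕ) : ℝ) + (#{p ∈ G | ¬ p.1 ≠ 0} : ℕ) = #G := by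
    exact_mod_cast card_filter_add_card_filter_not (s := G) (fun p => p.1 ≠ 0)
  have hx2 : 1 ≤ x ^ 2 := one_le_pow₀ hx1
  have hx68 : x ^ 6 ≤ x ^ 8 := pow_le_pow_right₀ hx1 (by norm_num)
  have hbound : (2 * M * M + M ^ 2 * (4 * (2 * (M / q : ℕ) + 1)) + 2 * (M * q) ^ 2 : ℝ) ≤
      22 * x ^ 8 := by
    calc (2 * M * M + M ^ 2 * (4 * (2 * (M / q : ℕ) + 1)) + 2 * (M * q) ^ 2 : ℝ)
        ≤ 2 * x ^ 3 * x ^ 3 + (x ^ 3) ^ 2 * (4 * (2 * x ^ 2 + x ^ 2)) +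
            2 * (x ^ 3 * (2 * x)) ^ 2 := by
          rw [hx3]
          gcongr
      _ = 2 * x ^ 6 + 20 * x ^ 8 := by ring
      _ ≤ 22 * x ^ 8 := by linarith
  rw [hx8]
  have hnz' := hnz.trans (mul_le_mul_of_nonneg_left hbound (by linarith))
  have hz' : ((#{p ∈ G | ¬ p.1 ≠ 0} : ℕ) : ℝ) ^ 2 ≤ #A * x ^ 8 := by
    calc ((#{p ∈ G | ¬ p.1 ≠ 0} : ℕ) : ℝ) ^ 2 ≤ (M : ℝ) ^ 2 :=
          pow_le_pow_left₀ (Nat.cast_nonneg _) hz 2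
      _ = 1 * x ^ 6 := by rw [hx3]; ring
      _ ≤ #A * x ^ 8 := mul_le_mul hn hx68 (by positivity) (by linarith)
  rw [← hsum]
  nlinarith [add_sq_le (a := ((#{p ∈ G | p.1 ≠ 0} : ℕ) : ℝ))
    (b := ((#{p ∈ G | ¬ p.1 ≠ 0} : ℕ) : ℝ))]

/-- Sums and products along graphs: there is an absolute constant `c > 0` such
that for all finite `A, B ⊆ ℝ` with `A` nonempty and all `G ⊆ A × B`,
`max {|A +_G B|, |A ·_G B|} ≥ c · |G|^(3/4) / |A|^(3/8)`. -/
theorem sum_product_graphs :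
    ∃ c : ℝ, 0 < c ∧
      ∀ (A B : Finset ℝ) (G : Finset (ℝ × ℝ)), A.Nonempty → G ⊆ A ×ˢ B →
        c * (G.card : ℝ) ^ ((3 : ℝ) / 4) / (A.card : ℝ) ^ ((3 : ℝ) / 8) ≤
          ((max (G.image (fun p => p.1 + p.2)).card
                (G.image (fun p => p.1 * p.2)).card : ℕ) : ℝ) := by
  refine ⟨((46 : ℝ) ^ ((3 : ℝ) / 8))⁻¹, by positivity, fun A B G hA hG => ?_⟩
  rcases G.eq_empty_or_nonempty with rfl | hne
  · simp
  set M := max (G.image (fun p => p.1 + p.2)).card (G.image (fun p => p.1 * p.2)).card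
  have hM : 0 < M := lt_max_of_lt_left (hne.image _).card_pos
  have h := sq_card_edges_le A B G hA hG hM (le_max_left _ _) (le_max_right _ _)
  have hn : (0 : ℝ) < A.card := by exact_mod_cast hA.card_pos
  have h' := Real.rpow_le_rpow (by positivity) h (by norm_num : (0 : ℝ) ≤ 3 / 8)
  rw [Real.mul_rpow (by positivity) (by positivity), Real.mul_rpow (by norm_num) hn.le,
    ← Real.rpow_natCast, ← Real.rpow_mul (by positivity), ← Real.rpow_mul (by positivity)] at h'
  norm_num at h'
  rw [div_le_iff₀ (by positivity), inv_mul_le_iff₀ (by positivity)]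
  linarith
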